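/- Let q be a prime power, n ≤ m, and let C ≤ F_{q^m}^n be an F_{q^m}-linear rank metric code with minimum distance d. Then |D_d(C)| · (q^m − 1) = A_d(C), where D_d(C) = {supp(c) : c ∈ C, wt(c) = d} and A_d(C) is the number of codewords of C of rank weight d. -/

import Mathlib

open Polynomial

/-- The `q`-ary Gaussian binomial coefficient `[a choose b]_q`. -/
def gaussBinom (q a b : ℕ) : ℕ :=
  if b ≤ a then
    (∏ i ∈ Finset.range b, (q ^ (a - i) - 1)) / (∏ i ∈ Finset.range b, (q ^ (i + 1) - 1))
  else 0

section Dual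

variable (K : Type) [Field K] {n : ℕ}

/-- The linear functional `v ↦ ∑ i, u i * v i` given by the standard inner product. -/
def dotL (u : Fin n → K) : (Fin n → K) →ₗ[K] K where
  toFun v := ∑ i, u i * v i
  map_add' a b := by simp [mul_add, Finset.sum_add_distrib]
  map_smul' c a := by simp [Finset.mul_sum, mul_left_comm]

/-- The dual code with respect to the standard inner product. -/
def dualCode (C : Submodule K (Fin n → K)) : Submodule K (Fin n → K) :=
  ⨅ u ∈ C, LinearMap.ker (dotL K u)

end Dual

section RankMetric

variable (Fq K : Type) [Field Fq] [Field K] [Algebra Fq K] {n : ℕ}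

/-- The rank weight of a vector `v ∈ K^n`, `K = F_{q^m}`, over `Fq`. -/
noncomputable def rankWt (v : Fin n → K) : ℕ :=
  Module.finrank Fq (Submodule.span Fq (Set.range v))

/-- The support of `v ∈ K^n`: the `Fq`-subspace of `Fq^n` of all coordinatewise
images of `v` under `Fq`-linear functionals of `K`. -/
def rsupp (v : Fin n → K) : Submodule Fq (Fin n → Fq) :=
  Submodule.span Fq {w : Fin n → Fq | ∃ f : K →ₗ[Fq] Fq, w = fun i => f (v i)}

/-- The support of an `K`-linear code `C ≤ K^n`. -/
def codeSupp (C : Submodule K (Fin n → K)) : Submodule Fq (Fin n → Fq) :=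
  ⨆ v ∈ C, rsupp Fq K v

/-- `C` has minimum rank distance `d`. -/
def IsMinRankDist (C : Submodule K (Fin n → K)) (d : ℕ) : Prop :=
  (∃ c ∈ C, c ≠ 0 ∧ rankWt Fq K c = d) ∧ ∀ c ∈ C, c ≠ 0 → d ≤ rankWt Fq K c

/-- The `r`-th generalized rank weight of `C`. -/
noncomputable def genRankWt (C : Submodule K (Fin n → K)) (r : ℕ) : ℕ :=
  sInf {w | ∃ D : Submodule K (Fin n → K), D ≤ C ∧ Module.finrank K D = r ∧
    Module.finrank Fq (codeSupp Fq K D) = w}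

end RankMetric

/-- A `q`-Steiner system `S_q(t,k,n)` with block set `B`: every block is a
`k`-dimensional `Fq`-subspace of `Fq^n`, and every `t`-dimensional subspace is
contained in exactly one block. -/
def IsSteinerSystemQ (Fq : Type) [Field Fq] (t k n : ℕ)
    (B : Set (Submodule Fq (Fin n → Fq))) : Prop :=
  (∀ b ∈ B, Module.finrank Fq b = k) ∧
  ∀ W : Submodule Fq (Fin n → Fq), Module.finrank Fq W = t → ∃! b, b ∈ B ∧ W ≤ b

section RankSupport

variable {Fq K : Type} [Field Fq] [Field K] [Algebra Fq K] {n : ℕ}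

theorem linearCombination_eq_zero_iff_rsupp (v : Fin n → K) (x : Fin n → Fq) :
    Fintype.linearCombination Fq v x = 0 ↔ ∀ w ∈ rsupp Fq K v, ∑ i, x i * w i = 0 := by
  constructor
  · intro hx w hw
    induction hw using Submodule.span_induction with
    | mem w hw =>
      obtain ⟨f, rfl⟩ := hw
      simpa [Fintype.linearCombination_apply] using congrArg f hx
    | zero => simp
    | add a b _ _ ha hb => simp [mul_add, Finset.sum_add_distrib, ha, hb]
    | smul r a _ ha =>
      simp only [Pi.smul_apply, smul_eq_mul, mul_left_comm _ r, ← Finset.mul_sum, ha, mul_zero]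
  · intro h
    rw [← Module.forall_dual_apply_eq_zero_iff Fq]
    intro f
    simpa [Fintype.linearCombination_apply] using h _ (Submodule.subset_span ⟨f, rfl⟩)

theorem ker_linearCombination_eq_of_rsupp_eq {v w : Fin n → K}
    (h : rsupp Fq K v = rsupp Fq K w) :
    LinearMap.ker (Fintype.linearCombination Fq v) =
      LinearMap.ker (Fintype.linearCombination Fq w) := by
  ext x
  simp only [LinearMap.mem_ker, linearCombination_eq_zero_iff_rsupp, h]

theorem rankWt_add_finrank_ker (v : Fin n → K) :
    rankWt Fq K v + Module.finrank Fq (LinearMap.ker (Fintype.linearCombination Fq v)) = n := by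
  rw [rankWt, ← Fintype.range_linearCombination, LinearMap.finrank_range_add_finrank_ker,
    Module.finrank_fin_fun]

theorem linearCombination_smul_vector (a : K) (v : Fin n → K) (x : Fin n → Fq) :
    Fintype.linearCombination Fq (a • v) x = a * Fintype.linearCombination Fq v x := by
  simp [Fintype.linearCombination_apply, Finset.mul_sum]

theorem rsupp_smul_le (a : K) (v : Fin n → K) : rsupp Fq K (a • v) ≤ rsupp Fq K v := by
  refine Submodule.span_mono ?_
  rintro _ ⟨f, rfl⟩
  exact ⟨f ∘ₗ LinearMap.mulLeft Fq a, rfl⟩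

theorem rsupp_smul {a : K} (ha : a ≠ 0) (v : Fin n → K) :
    rsupp Fq K (a • v) = rsupp Fq K v := by
  refine le_antisymm (rsupp_smul_le a v) ?_
  simpa [smul_smul, ha] using rsupp_smul_le (Fq := Fq) a⁻¹ (a • v)

theorem rankWt_eq_of_rsupp_eq {v w : Fin n → K} (h : rsupp Fq K v = rsupp Fq K w) :
    rankWt Fq K v = rankWt Fq K w := by
  have hv := rankWt_add_finrank_ker (Fq := Fq) v
  have hw := rankWt_add_finrank_ker (Fq := Fq) w
  rw [ker_linearCombination_eq_of_rsupp_eq h] at hv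
  omega

theorem ne_zero_of_rankWt_pos {v : Fin n → K} (h : 0 < rankWt Fq K v) : v ≠ 0 := by
  rintro rfl
  have hspan : Submodule.span Fq (Set.range (0 : Fin n → K)) = ⊥ := by
    rw [Submodule.span_eq_bot]
    rintro _ ⟨i, rfl⟩
    rfl
  rw [rankWt, hspan, finrank_bot] at h
  exact h.false

theorem rankWt_pos {v : Fin n → K} (hv : v ≠ 0) : 0 < rankWt Fq K v := by
  obtain ⟨i, hi⟩ := Function.ne_iff.mp hv
  have : Module.Finite Fq (Submodule.span Fq (Set.range v)) :=
    Module.Finite.span_of_finite Fq (Set.finite_range v)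
  rw [rankWt, Module.finrank_pos_iff_exists_ne_zero]
  exact ⟨⟨v i, Submodule.subset_span ⟨i, rfl⟩⟩, fun h => hi (congrArg Subtype.val h)⟩

theorem exists_rankWt_sub_smul_lt {v w : Fin n → K} (hv : v ≠ 0)
    (h : rsupp Fq K v = rsupp Fq K w) :
    ∃ a : K, rankWt Fq K (w - a • v) < rankWt Fq K v := by
  obtain ⟨i, hi⟩ := Function.ne_iff.mp hv
  refine ⟨w i / v i, ?_⟩
  set u := w - (w i / v i) • v with hu
  have hcomb (x : Fin n → Fq) : Fintype.linearCombination Fq u x =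
      Fintype.linearCombination Fq w x - w i / v i * Fintype.linearCombination Fq v x := by
    rw [← linearCombination_smul_vector]
    simp [hu, Fintype.linearCombination_apply, smul_sub, Finset.sum_sub_distrib]
  have hker : LinearMap.ker (Fintype.linearCombination Fq v) <
      LinearMap.ker (Fintype.linearCombination Fq u) := by
    refine SetLike.lt_iff_le_and_exists.mpr ⟨fun x hx => ?_, Pi.single i 1, ?_, ?_⟩
    · have hxw := hx
      rw [ker_linearCombination_eq_of_rsupp_eq h] at hxw
      rw [LinearMap.mem_ker] at hx hxw ⊢
      rw [hcomb, hx, hxw, mul_zero, sub_zero]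
    · have hi' : v i ≠ 0 := hi
      simp [hcomb, Fintype.linearCombination_apply_single, hi']
    · simpa [Fintype.linearCombination_apply_single] using hi
  have hlt := Submodule.finrank_lt_finrank_of_lt hker
  have hwv := rankWt_add_finrank_ker (Fq := Fq) v
  have hwu := rankWt_add_finrank_ker (Fq := Fq) u
  omega

theorem IsMinRankDist.exists_eq_smul {C : Submodule K (Fin n → K)} {d : ℕ}
    (hmin : IsMinRankDist Fq K C d) {v w : Fin n → K} (hvC : v ∈ C) (hwC : w ∈ C)
    (hv : v ≠ 0) (hd : rankWt Fq K v = d) (h : rsupp Fq K v = rsupp Fq K w) :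
    ∃ a : K, w = a • v := by
  obtain ⟨a, ha⟩ := exists_rankWt_sub_smul_lt hv h
  refine ⟨a, sub_eq_zero.mp ?_⟩
  by_contra hne
  have := hmin.2 _ (C.sub_mem hwC (C.smul_mem a hvC)) hne
  omega

end RankSupport

/-- The number of distinct supports of minimum-weight codewords times
`q^m − 1` equals the number `A_d(C)` of minimum-weight codewords. -/
theorem card_supports_mul_eq_card_min_weight
    (Fq K : Type) [Field Fq] [Fintype Fq] [Field K] [Fintype K] [Algebra Fq K]
    (q m n d : ℕ) (hq : Fintype.card Fq = q) (hm : Module.finrank Fq K = m) (hnm : n ≤ m)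
    (C : Submodule K (Fin n → K)) (hmin : IsMinRankDist Fq K C d) :
    ({S : Submodule Fq (Fin n → Fq) | ∃ c ∈ C, rankWt Fq K c = d ∧ rsupp Fq K c = S}.ncard)
        * (q ^ m - 1)
      = {c : Fin n → K | c ∈ C ∧ rankWt Fq K c = d}.ncard := by
  subst hq hm
  obtain ⟨⟨c₀, -, hc₀, hd₀⟩, -⟩ := id hmin
  have hne (c : Fin n → K) (hc : rankWt Fq K c = d) : c ≠ 0 :=
    ne_zero_of_rankWt_pos (Fq := Fq) (hc ▸ hd₀ ▸ rankWt_pos hc₀)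
  have hunits : Fintype.card Fq ^ Module.finrank Fq K - 1 = Nat.card Kˣ := by
    rw [Nat.card_units, Nat.card_eq_fintype_card, Module.card_eq_pow_finrank (K := Fq) (V := K)]
  rw [hunits, ← Nat.card_coe_set_eq, ← Nat.card_coe_set_eq, ← Nat.card_prod]
  choose r hrC hrd hrS using fun S : {S : Submodule Fq (Fin n → Fq) |
    ∃ c ∈ C, rankWt Fq K c = d ∧ rsupp Fq K c = S} => S.2
  refine Nat.card_eq_of_bijective (fun p => ⟨(p.2 : K) • r p.1, C.smul_mem _ (hrC p.1),
    (rankWt_eq_of_rsupp_eq (rsupp_smul p.2.ne_zero _)).trans (hrd p.1)⟩) ⟨?_, ?_⟩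
  · rintro ⟨S, a⟩ ⟨T, b⟩ hab
    have hab : (a : K) • r S = (b : K) • r T := congrArg Subtype.val hab
    have hST : S = T := by
      have := congrArg (rsupp Fq K) hab
      rw [rsupp_smul a.ne_zero, rsupp_smul b.ne_zero, hrS, hrS] at this
      exact Subtype.ext this
    subst hST
    rw [Units.ext (smul_left_injective K (hne _ (hrd S)) hab)]
  · rintro ⟨c, hcC, hcd⟩
    let S : {S : Submodule Fq (Fin n → Fq) |
      ∃ c ∈ C, rankWt Fq K c = d ∧ rsupp Fq K c = S} := ⟨rsupp Fq K c, c, hcC, hcd, rfl⟩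
    obtain ⟨a, ha⟩ := hmin.exists_eq_smul (hrC S) hcC (hne _ (hrd S)) (hrd S) (hrS S)
    have ha0 : a ≠ 0 := by
      rintro rfl
      exact hne c hcd (by rw [ha, zero_smul])
    exact ⟨(S, Units.mk0 a ha0), Subtype.ext ha.symm⟩
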